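/- arXiv:2202.02586 — 6 statements merged into one kernel-verified Lean document; each statement's English description precedes it below -/
import Mathlib

section
/- Let d be a nonnegative integer and let 𝓕 be a family of finite simple graphs that is closed under taking minors (if G ∈ 𝓕 then every minor of G belongs to 𝓕). If every graph in 𝓕 is d-degenerate, then every graph G ∈ 𝓕 admits an odd coloring using at most 2d+1 colors; that is, χ_o(G) ≤ 2d+1. -/
/-- `c` is a proper coloring of `G` with colors in `Fin k` that is *odd*: every
non-isolated vertex has some color appearing an odd number of times on its
neighborhood. -/
def SimpleGraph.IsOddColoring {V : Type*} {k : ℕ} (G : SimpleGraph V)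
    (c : V → Fin k) : Prop :=
  (∀ ⦃u v : V⦄, G.Adj u v → c u ≠ c v) ∧
  ∀ v : V, (∃ u, G.Adj v u) →
    ∃ a : Fin k, Odd (Nat.card {u : V // G.Adj v u ∧ c u = a})

/-- `G` admits an odd coloring using at most `k` colors. -/
def SimpleGraph.HasOddColoring {V : Type*} (G : SimpleGraph V) (k : ℕ) : Prop :=
  ∃ c : V → Fin k, G.IsOddColoring c

/-- `H` is a minor of `G`: there is a family of pairwise disjoint, nonempty,
connected branch sets in `G`, one for each vertex of `H`, such that any two
vertices adjacent in `H` have an edge of `G` joining their branch sets. -/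
def SimpleGraph.IsMinorOf {W V : Type*} (H : SimpleGraph W) (G : SimpleGraph V) : Prop :=
  ∃ f : W → Set V,
    (∀ w, (f w).Nonempty) ∧
    (∀ w, (G.induce (f w)).Connected) ∧
    (Pairwise fun w₁ w₂ => Disjoint (f w₁) (f w₂)) ∧
    (∀ ⦃w₁ w₂ : W⦄, H.Adj w₁ w₂ → ∃ v₁ ∈ f w₁, ∃ v₂ ∈ f w₂, G.Adj v₁ v₂)

/-- `G` is `d`-degenerate: every subgraph having at least one vertex has a
vertex of degree at most `d` (in that subgraph). -/
def SimpleGraph.Degenerate {V : Type*} (d : ℕ) (G : SimpleGraph V) : Prop :=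
  ∀ H : G.Subgraph, H.verts.Nonempty → ∃ v ∈ H.verts, Nat.card (H.neighborSet v) ≤ d

/-- Delete `v` and join `u` to all the other neighbors of `v`. When `v` is adjacent to `u`, this is
the contraction of the edge `vu`. -/
def SimpleGraph.contractInto {V : Type*} (G : SimpleGraph V) (v u : V) :
    SimpleGraph {x : V // x ≠ v} where
  Adj x y := G.Adj x y ∨ (x ≠ y ∧ ((x.1 = u ∧ G.Adj v y) ∨ (y.1 = u ∧ G.Adj v x)))
  symm := ⟨by
    rintro x y (h | ⟨h, h'⟩)
    · exact Or.inl h.symm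
    · exact Or.inr ⟨h.symm, h'.symm⟩⟩
  loopless := ⟨by
    rintro x (h | ⟨h, -⟩)
    · exact G.loopless.irrefl _ h
    · exact h rfl⟩

theorem SimpleGraph.contractInto_isMinorOf {V : Type*} (G : SimpleGraph V) {v u : V}
    (hu : (∃ w, G.Adj v w) → G.Adj v u) : (G.contractInto v u).IsMinorOf G := by
  refine ⟨fun w => {x | x = w.1 ∨ (x = v ∧ w.1 = u ∧ G.Adj v u)}, fun w => ⟨w, Or.inl rfl⟩,
    fun w => ?_, ?_, ?_⟩
  · rw [SimpleGraph.connected_iff_exists_forall_reachable]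
    refine ⟨⟨w.1, Or.inl rfl⟩, ?_⟩
    rintro ⟨x, rfl | ⟨rfl, hw, h⟩⟩
    · exact SimpleGraph.Reachable.refl _
    · refine SimpleGraph.Adj.reachable ?_
      change G.Adj w.1 x
      rw [hw]
      exact h.symm
  · intro w₁ w₂ h
    rw [Set.disjoint_left]
    rintro x (hx | ⟨hx, h₁, -⟩) (hx' | ⟨hx', h₂, -⟩)
    · exact h (Subtype.ext (hx.symm.trans hx'))
    · exact w₁.2 (hx.symm.trans hx')
    · exact w₂.2 (hx'.symm.trans hx)
    · exact h (Subtype.ext (h₁.trans h₂.symm))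
  · rintro w₁ w₂ (h | ⟨-, ⟨h, h'⟩ | ⟨h, h'⟩⟩)
    · exact ⟨_, Or.inl rfl, _, Or.inl rfl, h⟩
    · exact ⟨v, Or.inr ⟨rfl, h, hu ⟨_, h'⟩⟩, _, Or.inl rfl, h'⟩
    · exact ⟨_, Or.inl rfl, v, Or.inr ⟨rfl, h, hu ⟨_, h'⟩⟩, h'.symm⟩

theorem SimpleGraph.Degenerate.exists_card_neighborSet_le {V : Type*} [Nonempty V] {d : ℕ}
    {G : SimpleGraph V} (h : G.Degenerate d) : ∃ v, Nat.card (G.neighborSet v) ≤ d := by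
  obtain ⟨v, -, hv⟩ := h ⊤ Set.univ_nonempty
  refine ⟨v, ?_⟩
  rwa [show (⊤ : G.Subgraph).neighborSet v = G.neighborSet v from rfl] at hv

/-- An odd coloring of the graph obtained by contracting a vertex `v` of degree at most `d` into a
neighbor extends to `G`: at most `2 * d` colors are forbidden for `v`. -/
theorem SimpleGraph.HasOddColoring.of_contractInto {V : Type*} [Finite V] {d : ℕ}
    {G : SimpleGraph V} {v u : V} (hv : Nat.card (G.neighborSet v) ≤ d)
    (hu : (∃ w, G.Adj v w) → G.Adj v u)
    (h : (G.contractInto v u).HasOddColoring (2 * d + 1)) : G.HasOddColoring (2 * d + 1) := by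
  classical
  obtain ⟨c', hproper, hodd⟩ := h
  let c₀ : V → Fin (2 * d + 1) := fun x => if hx : x ≠ v then c' ⟨x, hx⟩ else 0
  have hc₀ : ∀ x (hx : x ≠ v), c₀ x = c' ⟨x, hx⟩ := fun x hx => dif_pos hx
  have hex : ∀ w, ∃ b, (∃ b', Odd (Nat.card {x // G.Adj w x ∧ x ≠ v ∧ c₀ x = b'})) →
      Odd (Nat.card {x // G.Adj w x ∧ x ≠ v ∧ c₀ x = b}) := by
    intro w
    by_cases hw : ∃ b', Odd (Nat.card {x // G.Adj w x ∧ x ≠ v ∧ c₀ x = b'})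
    · exact ⟨hw.choose, fun _ => hw.choose_spec⟩
    · exact ⟨0, fun h => absurd h hw⟩
  choose g hg using hex
  obtain ⟨a, ha⟩ : ∃ a, a ∉ c₀ '' G.neighborSet v ∪ g '' G.neighborSet v := by
    by_contra! hcon
    have h₁ := Set.ncard_union_le (c₀ '' G.neighborSet v) (g '' G.neighborSet v)
    rw [Set.eq_univ_of_forall hcon, Set.ncard_univ, Nat.card_fin] at h₁
    have h₂ := Set.ncard_image_le (f := c₀) (Set.toFinite (G.neighborSet v))
    have h₃ := Set.ncard_image_le (f := g) (Set.toFinite (G.neighborSet v))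
    rw [← Nat.card_coe_set_eq (G.neighborSet v)] at h₂ h₃
    omega
  have ha₁ : ∀ w, G.Adj v w → c₀ w ≠ a := fun w hw h => ha (Or.inl ⟨w, hw, h⟩)
  have ha₂ : ∀ w, G.Adj v w → g w ≠ a := fun w hw h => ha (Or.inr ⟨w, hw, h⟩)
  have hcv : Function.update c₀ v a v = a := Function.update_self ..
  have hcne : ∀ x, x ≠ v → Function.update c₀ v a x = c₀ x :=
    fun x hx => Function.update_of_ne hx ..
  refine ⟨Function.update c₀ v a, ?_, ?_⟩
  · intro x y hxy
    by_cases hx : x = v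
    · subst hx
      rw [hcv, hcne _ hxy.ne']
      exact (ha₁ _ hxy).symm
    · by_cases hy : y = v
      · subst hy
        rw [hcv, hcne _ hx]
        exact ha₁ _ hxy.symm
      · rw [hcne _ hx, hcne _ hy, hc₀ _ hx, hc₀ _ hy]
        exact hproper (Or.inl hxy)
  · intro w hw
    by_cases hwv : w = v
    · subst hwv
      have huw := hu hw
      refine ⟨c₀ u, ?_⟩
      have hset : {x | G.Adj w x ∧ Function.update c₀ w a x = c₀ u} = {u} := by
        ext x
        simp only [Set.mem_ofPred_eq, Set.mem_singleton_iff]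
        refine ⟨?_, ?_⟩
        · rintro ⟨hx, hxc⟩
          by_contra hne
          rw [hcne _ hx.ne', hc₀ _ hx.ne', hc₀ _ huw.ne'] at hxc
          exact hproper (Or.inr ⟨fun h => hne (congrArg Subtype.val h), Or.inr ⟨rfl, hx⟩⟩) hxc
        · rintro rfl
          exact ⟨huw, hcne _ huw.ne'⟩
      have hcard : Nat.card {x // G.Adj w x ∧ Function.update c₀ w a x = c₀ u} = 1 := by
        change Set.ncard {x | G.Adj w x ∧ Function.update c₀ w a x = c₀ u} = 1
        rw [hset, Set.ncard_singleton]
      rw [hcard]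
      exact odd_one
    · by_cases hvw : G.Adj v w
      · by_cases hw' : ∃ b', Odd (Nat.card {x // G.Adj w x ∧ x ≠ v ∧ c₀ x = b'})
        · refine ⟨g w, ?_⟩
          convert hg w hw' using 4 with x
          by_cases hx : x = v
          · subst hx
            simp [(ha₂ _ hvw).symm]
          · simp [hx]
        · refine ⟨a, ?_⟩
          have hset : {x | G.Adj w x ∧ Function.update c₀ v a x = a} =
              insert v {x | G.Adj w x ∧ x ≠ v ∧ c₀ x = a} := by
            ext x
            by_cases hx : x = v
            · subst hx
              simp [hvw.symm]
            · simp [hx]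
          have heven := Nat.not_odd_iff_even.1 (not_exists.1 hw' a)
          have hcard : Nat.card {x // G.Adj w x ∧ Function.update c₀ v a x = a} =
              Nat.card {x // G.Adj w x ∧ x ≠ v ∧ c₀ x = a} + 1 := by
            change Set.ncard {x | G.Adj w x ∧ Function.update c₀ v a x = a} =
              Set.ncard {x | G.Adj w x ∧ x ≠ v ∧ c₀ x = a} + 1
            rw [hset, Set.ncard_insert_of_notMem (by simp) (Set.toFinite _)]
          rw [hcard]
          exact heven.add_one
      · have hne : ∀ x, G.Adj w x → x ≠ v := by
          rintro x hx rfl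
          exact hvw hx.symm
        have hadj : ∀ x (hx : x ≠ v),
            (G.contractInto v u).Adj ⟨w, hwv⟩ ⟨x, hx⟩ ↔ G.Adj w x := by
          refine fun x hx => ⟨?_, Or.inl⟩
          rintro (h | ⟨-, ⟨h, h'⟩ | ⟨-, h⟩⟩)
          · exact h
          · have hwu : w = u := h
            exact absurd (hwu ▸ hu ⟨_, h'⟩) hvw
          · exact absurd h hvw
        obtain ⟨y, hy⟩ := hw
        obtain ⟨b, hb⟩ := hodd ⟨w, hwv⟩ ⟨⟨y, hne y hy⟩, Or.inl hy⟩
        refine ⟨b, ?_⟩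
        convert hb using 1
        refine Nat.card_congr
          { toFun := fun x => ⟨⟨x.1, hne _ x.2.1⟩, (hadj _ _).2 x.2.1, ?_⟩
            invFun := fun x => ⟨x.1.1, (hadj _ _).1 x.2.1, ?_⟩
            left_inv := fun _ => rfl
            right_inv := fun _ => rfl }
        · rw [← hc₀, ← hcne _ (hne _ x.2.1)]
          exact x.2.2
        · rw [hcne _ x.1.2, hc₀ _ x.1.2]
          exact x.2.2

/-- If `F` is a minor-closed family of finite simple graphs all of whose members are
`d`-degenerate, then every member of `F` admits an odd coloring with `2d+1` colors. -/
theorem oddColoring_of_minorClosed_degenerate (d : ℕ)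
    (F : ∀ (V : Type) [Finite V], SimpleGraph V → Prop)
    (hminor : ∀ (V W : Type) [Finite V] [Finite W] (G : SimpleGraph V) (H : SimpleGraph W),
      F V G → H.IsMinorOf G → F W H)
    (hdeg : ∀ (V : Type) [Finite V] (G : SimpleGraph V), F V G → G.Degenerate d) :
    ∀ (V : Type) [Finite V] (G : SimpleGraph V), F V G → G.HasOddColoring (2 * d + 1) := by
  intro V _ G hG
  induction hn : Nat.card V using Nat.strong_induction_on generalizing V with
  | _ n ih =>
    rcases isEmpty_or_nonempty V with hV | hV
    · exact ⟨fun x => hV.elim x, fun x => hV.elim x, fun x => hV.elim x⟩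
    · obtain ⟨v, hv⟩ := (hdeg V G hG).exists_card_neighborSet_le
      obtain ⟨u, hu⟩ : ∃ u, (∃ w, G.Adj v w) → G.Adj v u := by
        by_cases h : ∃ w, G.Adj v w
        · exact ⟨h.choose, fun _ => h.choose_spec⟩
        · exact ⟨v, fun h' => absurd h' h⟩
      refine .of_contractInto hv hu (ih _ ?_ _ _
        (hminor _ _ _ _ hG (G.contractInto_isMinorOf hu)) rfl)
      rw [← hn]
      exact Finite.card_subtype_lt (x := v) (by simp)
end

section
/- The odd chromatic number of the 5-cycle C_5 equals 5; that is, C_5 admits an odd coloring with 5 colors, and C_5 admits no odd coloring with fewer than 5 colors. -/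
namespace SimpleGraph

variable {V : Type*} {k : ℕ} {G : SimpleGraph V} {c : V → Fin k}

/-- Every injective coloring is odd. -/
theorem IsOddColoring.of_injective (hc : Function.Injective c) : G.IsOddColoring c := by
  refine ⟨fun u v h => hc.ne h.ne, fun v ⟨u, hu⟩ => ⟨c u, ?_⟩⟩
  have : Nat.card {w : V // G.Adj v w ∧ c w = c u} = 1 :=
    Nat.card_eq_one_iff_exists.2 ⟨⟨u, hu, rfl⟩, fun w => Subtype.ext (hc w.2.2)⟩
  simp [this]

/-- In an odd coloring, the two neighbors of a vertex of degree two get distinct colors. -/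
theorem IsOddColoring.ne_of_adj_iff (hc : G.IsOddColoring c) {v x y : V} (hxy : x ≠ y)
    (hv : ∀ u, G.Adj v u ↔ u = x ∨ u = y) : c x ≠ c y := by
  intro h
  obtain ⟨a, ha⟩ := hc.2 v ⟨x, (hv x).2 (Or.inl rfl)⟩
  by_cases hxa : c x = a
  · have hset : {u : V | G.Adj v u ∧ c u = a} = {x, y} := by
      ext u
      simp only [hv, Set.mem_ofPred_eq, Set.mem_insert_iff, Set.mem_singleton_iff]
      grind
    have hcard : Nat.card {u : V // G.Adj v u ∧ c u = a} = 2 :=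
      (congrArg Set.ncard hset).trans (Set.ncard_pair hxy)
    rw [hcard] at ha
    exact absurd ha (by decide)
  · have : IsEmpty {u : V // G.Adj v u ∧ c u = a} := ⟨fun ⟨u, hu, hua⟩ => by grind⟩
    simp at ha

/-- Any two vertices of the 5-cycle are adjacent or have a common neighbor, so every odd coloring
is injective. -/
theorem IsOddColoring.injective_of_cycleGraph_five {c : Fin 5 → Fin k}
    (hc : (cycleGraph 5).IsOddColoring c) : Function.Injective c := by
  have hadj : ∀ u : Fin 5, c u ≠ c (u + 1) := fun u =>
    hc.1 (by revert u; decide)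
  have hdist : ∀ u : Fin 5, c u ≠ c (u + 2) := fun u =>
    hc.ne_of_adj_iff (v := u + 1) (by revert u; decide) (by revert u; decide)
  intro u v huv
  have hcases : ∀ u v : Fin 5, u = v ∨ v = u + 1 ∨ v = u + 2 ∨ u = v + 1 ∨ u = v + 2 := by
    decide
  rcases hcases u v with h | rfl | rfl | rfl | rfl
  · exact h
  · exact absurd huv (hadj _)
  · exact absurd huv (hdist _)
  · exact absurd huv.symm (hadj _)
  · exact absurd huv.symm (hdist _)

end SimpleGraph

/-- The odd chromatic number of the 5-cycle is 5: it admits an odd coloring with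
5 colors, but none with fewer. -/
theorem oddChromaticNumber_cycleGraph_five :
    (SimpleGraph.cycleGraph 5).HasOddColoring 5 ∧
      ∀ k : ℕ, k < 5 → ¬ (SimpleGraph.cycleGraph 5).HasOddColoring k := by
  refine ⟨⟨id, .of_injective Function.injective_id⟩, fun k hk ⟨c, hc⟩ => ?_⟩
  have := Fintype.card_le_of_injective c hc.injective_of_cycleGraph_five
  simp only [Fintype.card_fin] at this
  omega
end

section
/- Let G be a finite simple graph, let v be a vertex of G whose degree deg_G(v) is odd, and let k be a positive integer with k ≥ 2·deg_G(v) + 1. If the graph G − v obtained by deleting v admits an odd coloring using at most k colors, then G admits an odd coloring using at most k colors. -/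
/-- If a finite set of odd size is colored, some color class has odd size. -/
theorem exists_odd_card_fiber {V α : Type*} [Finite V] [Finite α] {p : V → Prop}
    (hodd : Odd (Nat.card {u // p u})) (c : V → α) :
    ∃ a, Odd (Nat.card {u : V // p u ∧ c u = a}) := by
  classical
  have := Fintype.ofFinite V
  have := Fintype.ofFinite α
  by_contra! heven
  simp only [Nat.not_odd_iff_even, Nat.card_eq_fintype_card, Fintype.card_subtype] at heven hodd
  refine Nat.not_even_iff_odd.mpr hodd ?_
  rw [Finset.card_eq_sum_card_fiberwise (f := c) (t := Finset.univ) (by simp)]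
  exact Finset.even_sum _ fun a _ => by simpa only [Finset.filter_filter] using heven a

/-- Two functions on a set `s` with `2 * |s| < k` together miss some value in `Fin k`. -/
theorem exists_forall_mem_ne_and_ne {V : Type*} [Finite V] {k : ℕ} (s : Set V)
    (hs : 2 * Nat.card s < k) (f g : V → Fin k) : ∃ x, ∀ u ∈ s, f u ≠ x ∧ g u ≠ x := by
  have hne : f '' s ∪ g '' s ≠ Set.univ := by
    intro huniv
    have hcard := Set.ncard_union_le (f '' s) (g '' s)
    rw [huniv, Set.ncard_univ, Nat.card_fin] at hcard
    have hf := Set.ncard_image_le (f := f) s.toFinite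
    have hg := Set.ncard_image_le (f := g) s.toFinite
    rw [Nat.card_coe_set_eq] at hs
    omega
  obtain ⟨x, hx⟩ := (Set.ne_univ_iff_exists_notMem _).mp hne
  exact ⟨x, fun u hu => ⟨fun h => hx (.inl ⟨u, hu, h⟩), fun h => hx (.inr ⟨u, hu, h⟩)⟩⟩

/-- If `v` has odd degree, `k ≥ 2·deg_G(v) + 1`, and `G - v` admits an odd
`k`-coloring, then so does `G`. -/
theorem hasOddColoring_of_deleteOddVertex {V : Type*} [Finite V] (G : SimpleGraph V)
    (v : V) (hodd : Odd (Nat.card (G.neighborSet v)))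
    (k : ℕ) (hk0 : 0 < k) (hk : 2 * Nat.card (G.neighborSet v) + 1 ≤ k)
    (h : (G.induce {u : V | u ≠ v}).HasOddColoring k) :
    G.HasOddColoring k := by
  classical
  obtain ⟨c, hproper, hc⟩ := h
  have hwitness : ∀ u : V, ∃ a : Fin k, ∀ hu : u ≠ v, (∃ w, w ≠ v ∧ G.Adj u w) →
      Odd (Nat.card {w : {w : V | w ≠ v} // G.Adj u w ∧ c w = a}) := by
    intro u
    by_cases hu : u ≠ v ∧ ∃ w, w ≠ v ∧ G.Adj u w
    · obtain ⟨hu, w, hw, huw⟩ := hu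
      obtain ⟨a, ha⟩ := hc ⟨u, hu⟩ ⟨⟨w, hw⟩, huw⟩
      exact ⟨a, fun _ _ => ha⟩
    · exact ⟨⟨0, hk0⟩, fun h₁ h₂ => (hu ⟨h₁, h₂⟩).elim⟩
  choose f hf using hwitness
  obtain ⟨x, hx⟩ := exists_forall_mem_ne_and_ne (G.neighborSet v) hk
    (fun u => if hu : u ≠ v then c ⟨u, hu⟩ else ⟨0, hk0⟩) f
  let c' : V → Fin k := fun u => if hu : u ≠ v then c ⟨u, hu⟩ else x
  have hc'v : c' v = x := by simp [c']
  have hc' : ∀ u (hu : u ≠ v), c' u = c ⟨u, hu⟩ := fun u hu => by simp [c', hu]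
  have hxc : ∀ u, G.Adj v u → c' u ≠ x := by
    intro u hu
    simpa [hc' u hu.ne', hu.ne'] using (hx u hu).1
  refine ⟨c', ?_, ?_⟩
  · intro u w huw
    by_cases hu : u = v
    · subst hu
      rw [hc'v]
      exact (hxc w huw).symm
    by_cases hw : w = v
    · subst hw
      rw [hc'v]
      exact hxc u huw.symm
    rw [hc' u hu, hc' w hw]
    exact hproper (u := ⟨u, hu⟩) (v := ⟨w, hw⟩) huw
  · rintro u ⟨w, huw⟩
    by_cases hu : u = v
    · subst hu
      exact exists_odd_card_fiber hodd c'
    by_cases hnb : ∃ w, w ≠ v ∧ G.Adj u w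
    · refine ⟨f u, ?_⟩
      have hne : ∀ w, G.Adj u w ∧ c' w = f u → w ≠ v := by
        rintro w ⟨hw, hwf⟩ rfl
        exact (hx u hw.symm).2 (hwf.symm.trans hc'v)
      have hcard := hf u hu hnb
      rwa [Nat.card_congr ((Equiv.subtypeEquivRight
        (q := fun w : {w : V | w ≠ v} => G.Adj u w ∧ c' w = f u) fun w => by
          rw [hc' w w.2]).trans (Equiv.subtypeSubtypeEquivSubtype (hne _)))] at hcard
    · refine ⟨x, ?_⟩
      push Not at hnb
      have huv : ∀ w, G.Adj u w → w = v := fun w hw => by_contra fun h => hnb w h hw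
      have : Unique {w : V // G.Adj u w ∧ c' w = x} :=
        { default := ⟨v, huv w huw ▸ huw, hc'v⟩
          uniq := fun w => Subtype.ext (huv w w.2.1) }
      rw [Nat.card_unique]
      exact odd_one
end

section
/- Let G be a finite simple graph, let v and w be adjacent vertices of G, and let k be a positive integer with k ≥ 2·deg_G(v) + 1 and k ≥ 2·deg_G(w) + 1. If the graph G − {v, w} obtained by deleting both v and w admits an odd coloring using at most k colors, then G admits an odd coloring using at most k colors. -/
/-- If `k > |s| + |t| + 1`, some color in `Fin k` is not a value of `f` on `s`, not a value of `g`
on `t`, and different from `b`. -/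
theorem exists_fin_avoiding {V : Type*} [DecidableEq V] {k : ℕ} (f g : V → Fin k)
    (s t : Finset V) (b : Fin k) (hst : s.card + t.card + 1 < k) :
    ∃ a : Fin k, (∀ x ∈ s, f x ≠ a) ∧ (∀ x ∈ t, g x ≠ a) ∧ b ≠ a := by
  have hlt : (insert b (s.image f ∪ t.image g)).card < (Finset.univ : Finset (Fin k)).card := by
    have h₁ := Finset.card_insert_le b (s.image f ∪ t.image g)
    have h₂ := Finset.card_union_le (s.image f) (t.image g)
    have h₃ := Finset.card_image_le (s := s) (f := f)
    have h₄ := Finset.card_image_le (s := t) (f := g)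
    rw [Finset.card_fin]
    omega
  obtain ⟨a, -, ha⟩ := Finset.exists_mem_notMem_of_card_lt_card hlt
  simp only [Finset.mem_insert, Finset.mem_union, Finset.mem_image, not_or, not_exists,
    not_and] at ha
  exact ⟨a, ha.2.1, ha.2.2, Ne.symm ha.1⟩

/-- Recoloring two adjacent vertices `v`, `w` of a graph gives an odd coloring, provided the new
coloring is proper and each of the two new colors avoids a chosen color `o u` for each
neighbor `u`, where `o u` appears an odd number of times on the neighbors of `u` other than
`v` and `w` whenever some color does. -/
theorem SimpleGraph.isOddColoring_of_recolorPair {V : Type*} [Finite V] (G : SimpleGraph V)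
    {k : ℕ} {v w : V} (c : V → Fin k) (o : V → Fin k)
    (hproper : ∀ ⦃x y⦄, G.Adj x y → c x ≠ c y)
    (ho : ∀ u, (∃ a, Odd {x | G.Adj u x ∧ c x = a ∧ x ≠ v ∧ x ≠ w}.ncard) →
      Odd {x | G.Adj u x ∧ c x = o u ∧ x ≠ v ∧ x ≠ w}.ncard)
    (hov : ∀ u, G.Adj v u → o u ≠ c v) (how : ∀ u, G.Adj w u → o u ≠ c w)
    (hodd : ∀ u, u ≠ v → u ≠ w → (∃ x, G.Adj u x ∧ x ≠ v ∧ x ≠ w) →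
      ∃ a, Odd {x | G.Adj u x ∧ c x = a ∧ x ≠ v ∧ x ≠ w}.ncard)
    (hvw : G.Adj v w) : G.IsOddColoring c := by
  have hne := hproper hvw
  refine ⟨hproper, fun u ⟨y, huy⟩ => ?_⟩
  change ∃ a, Odd {x | G.Adj u x ∧ c x = a}.ncard
  by_cases hu : ∃ a, Odd {x | G.Adj u x ∧ c x = a ∧ x ≠ v ∧ x ≠ w}.ncard
  · refine ⟨o u, ?_⟩
    convert ho u hu using 3
    ext x
    refine ⟨fun ⟨h₁, h₂⟩ => ⟨h₁, h₂, ?_, ?_⟩, fun h => ⟨h.1, h.2.1⟩⟩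
    · rintro rfl
      exact hov u h₁.symm h₂.symm
    · rintro rfl
      exact how u h₁.symm h₂.symm
  · have heven : ∀ a, Even {x | G.Adj u x ∧ c x = a ∧ x ≠ v ∧ x ≠ w}.ncard := fun a =>
      Nat.not_odd_iff_even.1 fun h => hu ⟨a, h⟩
    by_cases huv : G.Adj u v
    · refine ⟨c v, ?_⟩
      have hins : {x | G.Adj u x ∧ c x = c v} =
          insert v {x | G.Adj u x ∧ c x = c v ∧ x ≠ v ∧ x ≠ w} := by
        ext x
        simp only [Set.mem_ofPred_eq, Set.mem_insert_iff]
        grind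
      rw [hins, Set.ncard_insert_of_notMem (by simp) (Set.toFinite _)]
      exact (heven _).add_one
    · by_cases huw : G.Adj u w
      · refine ⟨c w, ?_⟩
        have hins : {x | G.Adj u x ∧ c x = c w} =
            insert w {x | G.Adj u x ∧ c x = c w ∧ x ≠ v ∧ x ≠ w} := by
          ext x
          simp only [Set.mem_ofPred_eq, Set.mem_insert_iff]
          grind
        rw [hins, Set.ncard_insert_of_notMem (by simp) (Set.toFinite _)]
        exact (heven _).add_one
      · refine absurd (hodd u ?_ ?_ ⟨y, huy, ?_, ?_⟩) hu
        · rintro rfl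
          exact huw hvw
        · rintro rfl
          exact huv hvw.symm
        · rintro rfl
          exact huv huy
        · rintro rfl
          exact huw huy

/-- If `v` and `w` are adjacent, `k ≥ 2·deg_G(v) + 1`, `k ≥ 2·deg_G(w) + 1`, and
`G - {v, w}` admits an odd `k`-coloring, then so does `G`. -/
theorem hasOddColoring_of_deleteAdjacentPair {V : Type*} [Finite V] (G : SimpleGraph V)
    (v w : V) (hvw : G.Adj v w)
    (k : ℕ) (hk0 : 0 < k)
    (hkv : 2 * Nat.card (G.neighborSet v) + 1 ≤ k)
    (hkw : 2 * Nat.card (G.neighborSet w) + 1 ≤ k)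
    (h : (G.induce {u : V | u ≠ v ∧ u ≠ w}).HasOddColoring k) :
    G.HasOddColoring k := by
  classical
  have := Fintype.ofFinite V
  obtain ⟨c', hc', hodd'⟩ := h
  let c₀ : V → Fin k := fun x => if hx : x ≠ v ∧ x ≠ w then c' ⟨x, hx⟩ else ⟨0, hk0⟩
  have hc₀ : ∀ x (hx : x ≠ v ∧ x ≠ w), c₀ x = c' ⟨x, hx⟩ := fun x hx => dif_pos hx
  have hproper₀ : ∀ x y, x ≠ v → x ≠ w → y ≠ v → y ≠ w → G.Adj x y → c₀ x ≠ c₀ y := by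
    intro x y hxv hxw hyv hyw hxy
    rw [hc₀ x ⟨hxv, hxw⟩, hc₀ y ⟨hyv, hyw⟩]
    exact hc' (by simpa using hxy)
  have hodd₀ : ∀ u, u ≠ v → u ≠ w → (∃ x, G.Adj u x ∧ x ≠ v ∧ x ≠ w) →
      ∃ a, Odd {x | G.Adj u x ∧ c₀ x = a ∧ x ≠ v ∧ x ≠ w}.ncard := by
    rintro u huv huw ⟨x, hux, hx⟩
    obtain ⟨a, ha⟩ := hodd' ⟨u, huv, huw⟩ ⟨⟨x, hx⟩, by simpa using hux⟩
    refine ⟨a, ?_⟩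
    rw [← Nat.card_coe_set_eq]
    convert ha using 1
    refine Nat.card_congr
      { toFun := fun y => ⟨⟨y.1, y.2.2.2⟩, y.2.1, (hc₀ _ y.2.2.2).symm.trans y.2.2.1⟩
        invFun := fun y => ⟨y.1.1, y.2.1, (hc₀ _ y.1.2).trans y.2.2, y.1.2⟩
        left_inv := fun _ => rfl
        right_inv := fun _ => rfl }
  have hex : ∀ u, ∃ b, (∃ a, Odd {x | G.Adj u x ∧ c₀ x = a ∧ x ≠ v ∧ x ≠ w}.ncard) →
      Odd {x | G.Adj u x ∧ c₀ x = b ∧ x ≠ v ∧ x ≠ w}.ncard := by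
    intro u
    by_cases hu : ∃ a, Odd {x | G.Adj u x ∧ c₀ x = a ∧ x ≠ v ∧ x ≠ w}.ncard
    · exact hu.imp fun _ h _ => h
    · exact ⟨⟨0, hk0⟩, fun h => absurd h hu⟩
  choose o ho using hex
  rw [Nat.card_eq_fintype_card, G.card_neighborSet_eq_degree,
    ← G.card_neighborFinset_eq_degree] at hkv hkw
  have hwv : w ∈ G.neighborFinset v := by simpa using hvw
  have hvw' : v ∈ G.neighborFinset w := by simpa using hvw.symm
  have hcardv := Finset.card_erase_add_one hwv
  have hcardw := Finset.card_erase_add_one hvw'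
  obtain ⟨a, hca, hoa, -⟩ := exists_fin_avoiding c₀ o ((G.neighborFinset v).erase w)
    (G.neighborFinset v) ⟨0, hk0⟩ (by omega)
  obtain ⟨b, hcb, hob, hab⟩ := exists_fin_avoiding c₀ o ((G.neighborFinset w).erase v)
    (G.neighborFinset w) a (by omega)
  simp only [Finset.mem_erase, SimpleGraph.mem_neighborFinset] at hca hoa hcb hob
  let c : V → Fin k := fun x => if x = v then a else if x = w then b else c₀ x
  have hcv : c v = a := if_pos rfl
  have hcw : c w = b := by simp [c, hvw.ne']
  have hc : ∀ x, x ≠ v → x ≠ w → c x = c₀ x := fun x hxv hxw => by simp [c, hxv, hxw]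
  have hset : ∀ u e, {x | G.Adj u x ∧ c x = e ∧ x ≠ v ∧ x ≠ w} =
      {x | G.Adj u x ∧ c₀ x = e ∧ x ≠ v ∧ x ≠ w} := by
    intro u e
    ext x
    simp only [Set.mem_ofPred_eq]
    grind
  refine ⟨c, G.isOddColoring_of_recolorPair (v := v) (w := w) c o ?_ ?_ ?_ ?_ ?_ hvw⟩
  · intro x y hxy
    have hyx := hxy.symm
    have := hxy.ne
    grind
  · simpa only [hset] using ho
  · simpa only [hcv] using hoa
  · simpa only [hcw] using hob
  · simpa only [hset] using hodd₀
end

section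
/- Let k ≥ 4 be an integer, let G be a finite simple connected graph, and let xy be a bridge of G (an edge whose deletion disconnects G). Let G_1 and G_2 be the two connected components of G − xy, with x ∈ V(G_1) and y ∈ V(G_2). If both G_1 and G_2 admit odd colorings using at most k colors, then G admits an odd coloring using at most k colors. -/
namespace SimpleGraph

variable {V : Type*} {k : ℕ} {G H : SimpleGraph V}

/-- Permuting the colors of an odd coloring yields an odd coloring in which a given vertex and its
odd color have prescribed distinct values. -/
theorem HasOddColoring.exists_isOddColoring (h : G.HasOddColoring k) (v : V) {a b : Fin k}
    (hab : a ≠ b) :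
    ∃ c : V → Fin k, G.IsOddColoring c ∧ c v = a ∧
      ((∃ u, G.Adj v u) → Odd (Nat.card {u : V // G.Adj v u ∧ c u = b})) := by
  obtain ⟨c, hc, hodd⟩ := h
  obtain ⟨q, hqv, hq⟩ : ∃ q, q ≠ c v ∧
      ((∃ u, G.Adj v u) → Odd (Nat.card {u : V // G.Adj v u ∧ c u = q})) := by
    by_cases hv : ∃ u, G.Adj v u
    · obtain ⟨q, hq⟩ := hodd v hv
      refine ⟨q, ?_, fun _ => hq⟩
      obtain ⟨⟨u, hu, rfl⟩⟩ := (Nat.card_pos_iff.1 hq.pos).1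
      exact (hc hu).symm
    · have : Nontrivial (Fin k) := ⟨a, b, hab⟩
      obtain ⟨q, hq⟩ := exists_ne (c v)
      exact ⟨q, hq, fun h => absurd h hv⟩
  obtain ⟨σ, hσv, hσq⟩ : ∃ σ : Equiv.Perm (Fin k), σ (c v) = a ∧ σ q = b := by
    refine ⟨(Equiv.swap (c v) a).trans (Equiv.swap (Equiv.swap (c v) a q) b), ?_, by simp⟩
    have hne : a ≠ Equiv.swap (c v) a q := by
      intro h
      exact hqv ((Equiv.swap (c v) a).injective (h.symm.trans (Equiv.swap_apply_left _ _).symm))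
    simp [Equiv.swap_apply_of_ne_of_ne hne hab]
  refine ⟨σ ∘ c, ⟨fun u w huw => by simpa using hc huw, fun w hw => ?_⟩, hσv, fun hv => ?_⟩
  · obtain ⟨d, hd⟩ := hodd w hw
    exact ⟨σ d, by simpa using hd⟩
  · simpa [← hσq] using hq hv

/-- If `s` contains all neighbors of `v`, color classes on the neighborhood of `v` can be counted
in the subgraph induced by `s`. -/
theorem card_induce_adj_and_eq {α : Type*} {s : Set V} (v : s) (hs : ∀ u, G.Adj v u → u ∈ s)
    (c : V → α) (a : α) :
    Nat.card {u : s // (G.induce s).Adj v u ∧ c u = a} =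
      Nat.card {u : V // G.Adj v u ∧ c u = a} :=
  Nat.card_congr
    { toFun u := ⟨u.1, u.2⟩
      invFun u := ⟨⟨u.1, hs _ u.2.1⟩, u.2⟩
      left_inv _ := rfl
      right_inv _ := rfl }

/-- A coloring that is odd on each connected component is odd. -/
theorem isOddColoring_of_induce_supp {c : V → Fin k}
    (h : ∀ C : G.ConnectedComponent, (G.induce C.supp).IsOddColoring fun u => c u) :
    G.IsOddColoring c := by
  have hs (v u : V) (hvu : G.Adj v u) : u ∈ (G.connectedComponentMk v).supp :=
    ConnectedComponent.sound hvu.symm.reachable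
  refine ⟨fun u v huv => (h (G.connectedComponentMk u)).1
    (u := ⟨u, ConnectedComponent.connectedComponentMk_mem⟩) (v := ⟨v, hs u v huv⟩) huv,
    fun v ⟨u, hvu⟩ => ?_⟩
  obtain ⟨a, ha⟩ := (h (G.connectedComponentMk v)).2
    ⟨v, ConnectedComponent.connectedComponentMk_mem⟩
    ⟨⟨u, hs v u hvu⟩, hvu⟩
  exact ⟨a, card_induce_adj_and_eq (s := (G.connectedComponentMk v).supp)
    ⟨v, ConnectedComponent.connectedComponentMk_mem⟩ (hs v) c a ▸ ha⟩

/-- If `y` is the only possible new neighbor of `x`, and some color other than that of `y` appears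
an odd number of times around `x` unless `x` was isolated, then `x` has an odd color. -/
theorem exists_odd_card_of_adj_iff {α : Type*} {x y : V} {c : V → α} {b : α}
    (hG : ∀ u, G.Adj x u ↔ H.Adj x u ∨ u = y) (hyb : c y ≠ b)
    (hb : (∃ u, H.Adj x u) → Odd (Nat.card {u : V // H.Adj x u ∧ c u = b})) :
    ∃ a, Odd (Nat.card {u : V // G.Adj x u ∧ c u = a}) := by
  by_cases hx : ∃ u, H.Adj x u
  · refine ⟨b, ?_⟩
    have hiff (u : V) : G.Adj x u ∧ c u = b ↔ H.Adj x u ∧ c u = b := by grind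
    simpa only [hiff] using hb hx
  · push Not at hx
    refine ⟨c y, ?_⟩
    have : Nat.card {u : V // G.Adj x u ∧ c u = c y} = 1 := by
      rw [Nat.card_eq_one_iff_exists]
      refine ⟨⟨y, (hG y).2 (.inr rfl), rfl⟩, fun ⟨u, hu, _⟩ => ?_⟩
      simpa [hG, hx] using hu
    simp [this]

/-- Adding back an edge `xy` to a graph preserves an odd coloring if the colors of `x` and `y`
differ from each other and from the odd colors of `y` and `x`, respectively. -/
theorem IsOddColoring.of_deleteEdges {x y : V} {c : V → Fin k} {a b : Fin k} (hxy : G.Adj x y)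
    (hc : (G.deleteEdges {s(x, y)}).IsOddColoring c) (hne : c x ≠ c y)
    (hya : c y ≠ a) (hxb : c x ≠ b)
    (ha : (∃ u, (G.deleteEdges {s(x, y)}).Adj x u) →
      Odd (Nat.card {u : V // (G.deleteEdges {s(x, y)}).Adj x u ∧ c u = a}))
    (hb : (∃ u, (G.deleteEdges {s(x, y)}).Adj y u) →
      Odd (Nat.card {u : V // (G.deleteEdges {s(x, y)}).Adj y u ∧ c u = b})) :
    G.IsOddColoring c := by
  have hadj (u v : V) : (G.deleteEdges {s(x, y)}).Adj u v ↔
      G.Adj u v ∧ ¬(u = x ∧ v = y ∨ u = y ∧ v = x) := by simp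
  refine ⟨fun u v huv => ?_, fun v ⟨u, hvu⟩ => ?_⟩
  · by_cases h : u = x ∧ v = y ∨ u = y ∧ v = x
    · grind
    · exact hc.1 ((hadj u v).2 ⟨huv, h⟩)
  · by_cases hvx : v = x
    · subst hvx
      exact exists_odd_card_of_adj_iff (fun w => by grind [hxy.ne]) hya ha
    by_cases hvy : v = y
    · subst hvy
      exact exists_odd_card_of_adj_iff (fun w => by grind [hxy.ne, hxy.symm]) hxb hb
    have hv (w : V) : (G.deleteEdges {s(x, y)}).Adj v w ↔ G.Adj v w := by grind
    simpa only [hv] using hc.2 v ⟨u, (hv u).2 hvu⟩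

/-- Deleting an edge `xy` of a connected graph leaves every vertex connected to `x` or `y`. -/
theorem Connected.reachable_deleteEdges_or (hG : G.Connected) (x y v : V) :
    (G.deleteEdges {s(x, y)}).Reachable v x ∨ (G.deleteEdges {s(x, y)}).Reachable v y := by
  obtain ⟨p⟩ := hG v x
  induction p with
  | nil => exact .inl .rfl
  | @cons u w x huw p ih =>
    by_cases h : s(u, w) = s(x, y)
    · grind [Reachable.refl]
    · have : (G.deleteEdges {s(x, y)}).Adj u w := by simpa [huw] using h
      exact ih.imp this.reachable.trans this.reachable.trans

end SimpleGraph

open SimpleGraph in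
/-- If `xy` is a bridge of the connected graph `G`, `k ≥ 4`, and both components
of `G - xy` (the one containing `x` and the one containing `y`) admit odd
`k`-colorings, then so does `G`. -/
theorem hasOddColoring_of_bridge {V : Type*} [Finite V] (G : SimpleGraph V)
    (hG : G.Connected) (x y : V) (hb : G.IsBridge s(x, y))
    (k : ℕ) (hk : 4 ≤ k)
    (h1 : ((G.deleteEdges {s(x, y)}).induce
        ((G.deleteEdges {s(x, y)}).connectedComponentMk x).supp).HasOddColoring k)
    (h2 : ((G.deleteEdges {s(x, y)}).induce
        ((G.deleteEdges {s(x, y)}).connectedComponentMk y).supp).HasOddColoring k) :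
    G.HasOddColoring k := by
  classical
  have hxy : G.Adj x y := hb.reachable_iff_adj.1 (hG x y)
  have hnr := isBridge_iff.1 hb
  set H := G.deleteEdges {s(x, y)}
  obtain ⟨c₁, hc₁, hx, hxb⟩ := h1.exists_isOddColoring
    ⟨x, ConnectedComponent.connectedComponentMk_mem⟩
    (a := ⟨0, by lia⟩) (b := ⟨1, by lia⟩) (by simp)
  obtain ⟨c₂, hc₂, hy, hyb⟩ := h2.exists_isOddColoring
    ⟨y, ConnectedComponent.connectedComponentMk_mem⟩
    (a := ⟨2, by lia⟩) (b := ⟨3, by lia⟩) (by simp)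
  obtain ⟨c, h₁, h₂⟩ : ∃ c : V → Fin k,
      (fun u : (H.connectedComponentMk x).supp => c u) = c₁ ∧
      (fun u : (H.connectedComponentMk y).supp => c u) = c₂ := by
    refine ⟨fun u => if h : u ∈ (H.connectedComponentMk x).supp then c₁ ⟨u, h⟩ else
      if h : u ∈ (H.connectedComponentMk y).supp then c₂ ⟨u, h⟩ else ⟨0, by lia⟩, ?_, ?_⟩
    · ext ⟨u, hu⟩
      simp only [dif_pos hu]
    · ext ⟨u, hu⟩
      have hu' : u ∉ (H.connectedComponentMk x).supp := fun h =>
        hnr (ConnectedComponent.exact (h.symm.trans hu))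
      simp only [dif_neg hu', dif_pos hu]
  subst h₁ h₂
  dsimp only at hx hy
  have hs (v u : V) (hvu : H.Adj v u) : u ∈ (H.connectedComponentMk v).supp :=
    ConnectedComponent.sound hvu.symm.reachable
  have hc : H.IsOddColoring c := by
    refine isOddColoring_of_induce_supp fun C => ?_
    induction C using ConnectedComponent.ind with | h v => ?_
    rcases hG.reachable_deleteEdges_or x y v with h | h
    · rwa [ConnectedComponent.sound h]
    · rwa [ConnectedComponent.sound h]
  rw [card_induce_adj_and_eq (s := (H.connectedComponentMk x).supp)
    ⟨x, ConnectedComponent.connectedComponentMk_mem⟩ (hs x) c] at hxb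
  rw [card_induce_adj_and_eq (s := (H.connectedComponentMk y).supp)
    ⟨y, ConnectedComponent.connectedComponentMk_mem⟩ (hs y) c] at hyb
  exact ⟨c, hc.of_deleteEdges hxy (by simp [hx, hy]) (by simp [hy]) (by simp [hx])
    (fun ⟨u, hu⟩ => hxb ⟨⟨u, hs x u hu⟩, hu⟩) (fun ⟨u, hu⟩ => hyb ⟨⟨u, hs y u hu⟩, hu⟩)⟩
end

section
/- Let k ≥ 5 be an integer, let G be a finite simple graph, let v be a vertex of G, and let S be the set of all neighbors of v that have degree exactly 2 in G. Assume S is nonempty, that no two vertices of S are adjacent, and that 2·deg_G(v) − |S| ≤ k − 1. If the graph G − ({v} ∪ S) obtained by deleting v and all vertices of S admits an odd coloring using at most k colors, then G admits an odd coloring using at most k colors. -/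
namespace SimpleGraph

variable {V : Type*} {k : ℕ} {G : SimpleGraph V}

/-- The restriction of `c` to `T` is a proper coloring. -/
def IsProperOn (G : SimpleGraph V) (T : Set V) (c : V → Fin k) : Prop :=
  ∀ ⦃u⦄, u ∈ T → ∀ ⦃w⦄, w ∈ T → G.Adj u w → c u ≠ c w

/-- Some color appears an odd number of times on the neighbors of `y` in `T`. -/
def IsOddAt (G : SimpleGraph V) (T : Set V) (c : V → Fin k) (y : V) : Prop :=
  ∃ a, Odd {u | u ∈ T ∧ G.Adj y u ∧ c u = a}.ncard

lemma isOddColoring_iff_univ {c : V → Fin k} :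
    G.IsOddColoring c ↔
      G.IsProperOn Set.univ c ∧ ∀ y, (∃ u, G.Adj y u) → G.IsOddAt Set.univ c y := by
  simp only [IsOddColoring, IsProperOn, IsOddAt, Set.mem_univ, true_and, true_imp_iff,
    ← Nat.card_coe_set_eq, Set.coe_ofPred]

open Function in
/-- Coloring one more vertex destroys the oddness at `y` for at most one choice of color, and
creates it for all other choices if `y` is adjacent to the new vertex. -/
lemma exists_isOddAt_insert_update [Finite V] [DecidableEq V] [NeZero k]
    (G : SimpleGraph V) (T : Set V) (c : V → Fin k) {w : V} (hw : w ∉ T) (y : V) :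
    ∃ a, ∀ b, b ≠ a → G.Adj y w ∨ G.IsOddAt T c y →
      G.IsOddAt (insert w T) (update c w b) y := by
  have off (a b : Fin k) (h : b ≠ a) :
      {u | u ∈ insert w T ∧ G.Adj y u ∧ update c w b u = a} =
        {u | u ∈ T ∧ G.Adj y u ∧ c u = a} := by
    ext u
    by_cases hu : u = w
    · subst hu; simp [h, hw]
    · simp only [Set.mem_ofPred_eq, Set.mem_insert_iff, hu, false_or, ne_eq, not_false_eq_true,
        Function.update_of_ne]
  by_cases hy : G.IsOddAt T c y
  · obtain ⟨a, ha⟩ := hy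
    exact ⟨a, fun b hb _ ↦ ⟨a, by rwa [off a b hb]⟩⟩
  · refine ⟨0, fun b _ h ↦ ⟨b, ?_⟩⟩
    have hadj := h.resolve_right hy
    have key : {u | u ∈ insert w T ∧ G.Adj y u ∧ update c w b u = b} =
        insert w {u | u ∈ T ∧ G.Adj y u ∧ c u = b} := by
      ext u
      by_cases hu : u = w
      · subst hu; simp [hadj]
      · simp only [Set.mem_ofPred_eq, Set.mem_insert_iff, hu, false_or, ne_eq, not_false_eq_true,
        Function.update_of_ne]
    rw [key, Set.ncard_insert_of_notMem (by simp [hw]), Nat.odd_add_one]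
    exact fun hb ↦ hy ⟨b, hb⟩

open Function in
lemma isOddAt_insert_update_of_not_adj [DecidableEq V] {T : Set V} {c : V → Fin k} {w y : V}
    (hadj : ¬ G.Adj y w) (h : G.IsOddAt T c y) (b : Fin k) :
    G.IsOddAt (insert w T) (update c w b) y := by
  obtain ⟨a, ha⟩ := h
  refine ⟨a, ?_⟩
  convert ha using 3
  ext u
  by_cases hu : u = w
  · subst hu; simp [hadj]
  · simp only [Set.mem_insert_iff, hu, false_or, ne_eq, not_false_eq_true,
        Function.update_of_ne]

/-- A proper coloring of `T` extends to one more vertex `w` so that oddness is kept everywhere and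
created at all neighbors of `w`, as soon as there are enough colors. -/
lemma IsProperOn.exists_insert [Finite V] {T : Set V} {c : V → Fin k}
    (hc : G.IsProperOn T c) {w : V} (hw : w ∉ T)
    (hk : (G.neighborSet w).ncard + (G.neighborSet w ∩ T).ncard < k) :
    ∃ c' : V → Fin k, G.IsProperOn (insert w T) c' ∧
      ∀ y, G.Adj y w ∨ G.IsOddAt T c y → G.IsOddAt (insert w T) c' y := by
  classical
  have : NeZero k := ⟨by omega⟩
  choose o ho using exists_isOddAt_insert_update G T c hw
  obtain ⟨b, hb⟩ : ∃ b, b ∉ o '' G.neighborSet w ∪ c '' (G.neighborSet w ∩ T) := by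
    by_contra! hall
    have h₁ := Set.ncard_union_le (o '' G.neighborSet w) (c '' (G.neighborSet w ∩ T))
    rw [Set.eq_univ_of_forall hall, Set.ncard_univ, Nat.card_fin] at h₁
    have h₂ := Set.ncard_image_le (f := o) (Set.toFinite (G.neighborSet w))
    have h₃ := Set.ncard_image_le (f := c) (Set.toFinite (G.neighborSet w ∩ T))
    omega
  have hbo {y} (hy : G.Adj y w) : b ≠ o y :=
    fun h ↦ hb (Or.inl ⟨y, hy.symm, h.symm⟩)
  have hbc {y} (hy : G.Adj y w) (hyT : y ∈ T) : b ≠ c y :=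
    fun h ↦ hb (Or.inr ⟨y, ⟨hy.symm, hyT⟩, h.symm⟩)
  have hne {y} (hy : y ∈ T) : y ≠ w := fun h ↦ hw (h ▸ hy)
  refine ⟨Function.update c w b, ?_, fun y hy ↦ ?_⟩
  · rintro u (rfl | hu) x (rfl | hx) hux
    · exact (G.irrefl hux).elim
    · simpa [hne hx] using hbc hux.symm hx
    · simpa [hne hu] using (hbc hux hu).symm
    · simpa [hne hu, hne hx] using hc hu hx hux
  · by_cases hyw : G.Adj y w
    · exact ho y b (hbo hyw) hy
    · exact isOddAt_insert_update_of_not_adj hyw (hy.resolve_left hyw) b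

/-- A proper coloring of `T` extends to any set of vertices of small degree so that oddness is kept
everywhere and created at all their neighbors. -/
lemma IsProperOn.exists_union [Finite V] {T : Set V} {c : V → Fin k}
    (hc : G.IsProperOn T c) (W : Set V) (hdisj : Disjoint W T)
    (hk : ∀ w ∈ W, 2 * (G.neighborSet w).ncard < k) :
    ∃ c' : V → Fin k, G.IsProperOn (W ∪ T) c' ∧
      ∀ y, (∃ w ∈ W, G.Adj y w) ∨ G.IsOddAt T c y → G.IsOddAt (W ∪ T) c' y := by
  induction W, Set.toFinite W using Set.Finite.induction_on with
  | empty => exact ⟨c, by simpa using hc, by simp⟩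
  | @insert w W hwW _ ih =>
    rw [Set.disjoint_insert_left] at hdisj
    obtain ⟨c₁, hc₁, hodd₁⟩ := ih hdisj.2 fun x hx ↦ hk x (Set.mem_insert_of_mem _ hx)
    have hcard := hk w (Set.mem_insert _ _)
    have hle := Set.ncard_le_ncard
      (Set.inter_subset_left (s := G.neighborSet w) (t := W ∪ T)) (Set.toFinite _)
    obtain ⟨c₂, hc₂, hodd₂⟩ := hc₁.exists_insert (w := w) (by simp [hwW, hdisj.1]) (by omega)
    rw [Set.insert_union]
    refine ⟨c₂, hc₂, fun y hy ↦ hodd₂ y ?_⟩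
    rcases hy with ⟨x, rfl | hx, hyx⟩ | hy
    · exact Or.inl hyx
    · exact Or.inr (hodd₁ y (Or.inl ⟨x, hx, hyx⟩))
    · exact Or.inr (hodd₁ y (Or.inr hy))

/-- An odd coloring of an induced subgraph, as a partial coloring of the whole graph. -/
lemma HasOddColoring.exists_of_induce [NeZero k] {T : Set V}
    (h : (G.induce T).HasOddColoring k) :
    ∃ c : V → Fin k, G.IsProperOn T c ∧
      ∀ y ∈ T, (∃ u ∈ T, G.Adj y u) → G.IsOddAt T c y := by
  classical
  obtain ⟨c, hc, hodd⟩ := h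
  refine ⟨fun u ↦ if hu : u ∈ T then c ⟨u, hu⟩ else 0, fun u hu w hw huw ↦ ?_,
    fun y hy ⟨u, hu, hyu⟩ ↦ ?_⟩
  · simpa [hu, hw] using hc (u := ⟨u, hu⟩) (v := ⟨w, hw⟩) huw
  · obtain ⟨a, ha⟩ := hodd ⟨y, hy⟩ ⟨⟨u, hu⟩, hyu⟩
    refine ⟨a, ?_⟩
    rw [← Nat.card_coe_set_eq]
    convert ha using 1
    refine Nat.card_congr
      { toFun := fun x ↦ ⟨⟨x, x.2.1⟩, x.2.2.1, by simpa [x.2.1] using x.2.2.2⟩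
        invFun := fun x ↦ ⟨x, x.1.2, x.2.1, by simpa using x.2.2⟩
        left_inv := fun _ ↦ rfl
        right_inv := fun _ ↦ rfl }

end SimpleGraph

/-- Let `S` be the set of degree-2 neighbors of `v`; if `S` is nonempty and
independent, `2·deg_G(v) - |S| ≤ k - 1` with `k ≥ 5`, and `G - ({v} ∪ S)` admits
an odd `k`-coloring, then so does `G`. -/
theorem hasOddColoring_of_deleteVertexAndDegreeTwoNeighbors
    {V : Type*} [Finite V] (G : SimpleGraph V) (v : V)
    (k : ℕ) (hk : 5 ≤ k)
    (S : Set V) (hS : S = {u : V | G.Adj v u ∧ Nat.card (G.neighborSet u) = 2})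
    (hne : S.Nonempty)
    (hind : ∀ a ∈ S, ∀ b ∈ S, ¬ G.Adj a b)
    (hcard : 2 * Nat.card (G.neighborSet v) - S.ncard ≤ k - 1)
    (h : (G.induce ({v} ∪ S)ᶜ).HasOddColoring k) :
    G.HasOddColoring k := by
  have : NeZero k := ⟨by omega⟩
  obtain ⟨c₀, hc₀, hodd₀⟩ := h.exists_of_induce
  have hSv : ∀ s ∈ S, G.Adj v s := fun s hs ↦ by rw [hS] at hs; exact hs.1
  have hvS : v ∉ S := fun hv ↦ G.irrefl (hSv v hv)
  have hinter : G.neighborSet v ∩ ({v} ∪ S)ᶜ = G.neighborSet v \ S := by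
    ext u
    simp only [Set.mem_inter_iff, SimpleGraph.mem_neighborSet, Set.mem_compl_iff, Set.mem_union,
      Set.mem_singleton_iff, Set.mem_sdiff, not_or]
    exact ⟨fun h ↦ ⟨h.1, h.2.2⟩, fun h ↦ ⟨h.1, h.1.ne', h.2⟩⟩
  have hdiff := Set.ncard_sdiff_add_ncard_of_subset (s := S) (t := G.neighborSet v) hSv
  obtain ⟨c₁, hc₁, hodd₁⟩ := hc₀.exists_insert (w := v) (by simp) (by
    rw [hinter]
    rw [Nat.card_coe_set_eq] at hcard
    omega)
  obtain ⟨c₂, hc₂, hodd₂⟩ := hc₁.exists_union S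
    (Set.disjoint_left.2 fun s hs ↦ by simp [hs, (hSv s hs).ne'])
    (fun s hs ↦ by
      rw [hS] at hs
      rw [← Nat.card_coe_set_eq, hs.2]
      omega)
  have huniv : S ∪ insert v ({v} ∪ S)ᶜ = Set.univ := by
    ext u
    by_cases u = v <;> by_cases u ∈ S <;> simp_all
  rw [huniv] at hc₂ hodd₂
  refine ⟨c₂, SimpleGraph.isOddColoring_iff_univ.2 ⟨hc₂, fun y ⟨u, hyu⟩ ↦ hodd₂ y ?_⟩⟩
  by_cases hyS : ∃ s ∈ S, G.Adj y s
  · exact Or.inl hyS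
  refine Or.inr (hodd₁ y ?_)
  by_cases hyv : G.Adj y v
  · exact Or.inl hyv
  refine Or.inr (hodd₀ y ?_ ⟨u, ?_, hyu⟩)
  · rintro (rfl | hy)
    · exact hyS ⟨_, hne.some_mem, hSv _ hne.some_mem⟩
    · exact hyv (hSv y hy).symm
  · rintro (rfl | hu)
    · exact hyv hyu
    · exact hyS ⟨u, hu, hyu⟩
end
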